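/- Let a > 0. For t ∈ ℝ let φ_t be the projective transformation of ℙ(ℝ³) induced by the matrix [[e^{at}, 0, 0],[0, 1, t],[0, 0, 1]], and let ψ_t be the projective transformation of ℙ(ℝ³) induced by the matrix [[1, t, 0],[0, 1, 0],[0, 0, e^{−at}]]. Then there is no homeomorphism h of ℙ(ℝ³) satisfying h ∘ φ_t = ψ_t ∘ h for all t ∈ ℝ; that is, the two one-parameter flows on the real projective plane are not topologically conjugate. -/

import Mathlib

open Matrix Filter
open scoped LinearAlgebra.Projectivization

/-- The quotient topology on the real projective plane, induced from `(Fin 3 → ℝ) \ {0}`. -/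
noncomputable instance : TopologicalSpace (ℙ ℝ (Fin 3 → ℝ)) := by
  unfold Projectivization; infer_instance

/-- The matrices inducing the first flow on the projective plane. -/
noncomputable def phiMat (a t : ℝ) : Matrix (Fin 3) (Fin 3) ℝ :=
  !![Real.exp (a * t), 0, 0;
     0, 1, t;
     0, 0, 1]

/-- The matrices inducing the second flow on the projective plane. -/
noncomputable def psiMat (a t : ℝ) : Matrix (Fin 3) (Fin 3) ℝ :=
  !![1, t, 0;
     0, 1, 0;
     0, 0, Real.exp (-(a * t))]

lemma phiMat_injective (a t : ℝ) : Function.Injective (phiMat a t).mulVecLin := by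
  rw [Matrix.coe_mulVecLin]
  refine Matrix.mulVec_injective_iff_isUnit.mpr ((Matrix.isUnit_iff_isUnit_det _).mpr ?_)
  have hdet : (phiMat a t).det = Real.exp (a * t) := by
    simp [phiMat, Matrix.det_fin_three]
  rw [hdet, isUnit_iff_ne_zero]
  exact Real.exp_ne_zero _

lemma psiMat_injective (a t : ℝ) : Function.Injective (psiMat a t).mulVecLin := by
  rw [Matrix.coe_mulVecLin]
  refine Matrix.mulVec_injective_iff_isUnit.mpr ((Matrix.isUnit_iff_isUnit_det _).mpr ?_)
  have hdet : (psiMat a t).det = Real.exp (-(a * t)) := by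
    simp [psiMat, Matrix.det_fin_three]
  rw [hdet, isUnit_iff_ne_zero]
  exact Real.exp_ne_zero _

/-- The projective transformation induced by `phiMat a t`. -/
noncomputable def phi (a t : ℝ) : ℙ ℝ (Fin 3 → ℝ) → ℙ ℝ (Fin 3 → ℝ) :=
  Projectivization.map (phiMat a t).mulVecLin (phiMat_injective a t)

/-- The projective transformation induced by `psiMat a t`. -/
noncomputable def psi (a t : ℝ) : ℙ ℝ (Fin 3 → ℝ) → ℙ ℝ (Fin 3 → ℝ) :=
  Projectivization.map (psiMat a t).mulVecLin (psiMat_injective a t)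

lemma continuous_projectivization_mk :
    Continuous (fun v : {v : Fin 3 → ℝ // v ≠ 0} => Projectivization.mk ℝ v.1 v.2) :=
  continuous_quotient_mk'

/-- The squared cosine of the angle between a line and the first coordinate axis. -/
noncomputable def firstCoordSq : ℙ ℝ (Fin 3 → ℝ) → ℝ :=
  Projectivization.lift
    (fun v : {v : Fin 3 → ℝ // v ≠ 0} => v.1 0 ^ 2 / (v.1 0 ^ 2 + v.1 1 ^ 2 + v.1 2 ^ 2)) (by
      rintro ⟨v, hv⟩ ⟨w, hw⟩ t h
      have h' : v = t • w := h
      have ht : t ≠ 0 := by rintro rfl; exact hv (by simpa using h')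
      subst h'
      simp only [Pi.smul_apply, smul_eq_mul, mul_pow, ← mul_add]
      exact mul_div_mul_left _ _ (pow_ne_zero 2 ht))

lemma firstCoordSq_mk (v : Fin 3 → ℝ) (hv : v ≠ 0) :
    firstCoordSq (Projectivization.mk ℝ v hv) = v 0 ^ 2 / (v 0 ^ 2 + v 1 ^ 2 + v 2 ^ 2) :=
  rfl

lemma continuous_firstCoordSq : Continuous firstCoordSq := by
  refine Continuous.quotient_lift (s := projectivizationSetoid ℝ (Fin 3 → ℝ))
    (f := fun v : {v : Fin 3 → ℝ // v ≠ 0} =>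
      v.1 0 ^ 2 / (v.1 0 ^ 2 + v.1 1 ^ 2 + v.1 2 ^ 2)) ?_ _
  have hc (i : Fin 3) : Continuous fun v : {v : Fin 3 → ℝ // v ≠ 0} => v.1 i :=
    (continuous_apply i).comp continuous_subtype_val
  refine Continuous.div ((hc 0).pow 2) ((((hc 0).pow 2).add ((hc 1).pow 2)).add ((hc 2).pow 2)) ?_
  rintro ⟨v, hv⟩ h
  refine hv (funext fun i => ?_)
  have h0 := sq_nonneg (v 0)
  have h1 := sq_nonneg (v 1)
  have h2 := sq_nonneg (v 2)
  simp only at h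
  refine pow_eq_zero_iff two_ne_zero |>.mp ?_
  fin_cases i <;> simp only [Fin.isValue, Fin.zero_eta, Fin.mk_one, Fin.reduceFinMk] <;> linarith

lemma tendsto_projectivization_mk {ι : Type*} {l : Filter ι} {u : ι → ℙ ℝ (Fin 3 → ℝ)}
    {w : ι → Fin 3 → ℝ} {v : Fin 3 → ℝ} (hv : v ≠ 0) (hwv : Tendsto w l (nhds v))
    (hu : ∀ᶠ i in l, ∃ hi : w i ≠ 0, u i = Projectivization.mk ℝ (w i) hi) :
    Tendsto u l (nhds (Projectivization.mk ℝ v hv)) := by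
  classical
  let w' : ι → {v : Fin 3 → ℝ // v ≠ 0} := fun i =>
    if hi : w i ≠ 0 then ⟨w i, hi⟩ else ⟨v, hv⟩
  have hw' : Tendsto w' l (nhds ⟨v, hv⟩) := by
    rw [tendsto_subtype_rng]
    refine hwv.congr' ?_
    filter_upwards [hu] with i ⟨hi, _⟩
    simp [w', hi]
  refine ((continuous_projectivization_mk.tendsto ⟨v, hv⟩).comp hw').congr' ?_
  filter_upwards [hu] with i ⟨hi, h⟩
  simp [w', hi, h]

lemma basis_zero_ne_zero : (![1, 0, 0] : Fin 3 → ℝ) ≠ 0 := fun h => one_ne_zero (congrFun h 0)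

lemma phiMat_mulVec (a t x y z : ℝ) :
    phiMat a t *ᵥ ![x, y, z] = ![Real.exp (a * t) * x, y + t * z, z] := by
  ext i; fin_cases i <;> simp [phiMat, Matrix.mulVec, dotProduct, Fin.sum_univ_three]

lemma psiMat_mulVec (a t : ℝ) (v : Fin 3 → ℝ) :
    psiMat a t *ᵥ v = ![v 0 + t * v 1, v 1, Real.exp (-(a * t)) * v 2] := by
  ext i; fin_cases i <;> simp [psiMat, Matrix.mulVec, dotProduct, Fin.sum_univ_three]

lemma firstCoordSq_phi (a t x y z : ℝ) (hv : ![x, y, z] ≠ 0) :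
    firstCoordSq (phi a t (Projectivization.mk ℝ ![x, y, z] hv)) =
      (Real.exp (a * t) * x) ^ 2 / ((Real.exp (a * t) * x) ^ 2 + (y + t * z) ^ 2 + z ^ 2) := by
  rw [phi, Projectivization.map_mk, firstCoordSq_mk]
  simp only [Matrix.mulVecLin_apply, phiMat_mulVec]
  simp

lemma psi_mk_eq (a t c : ℝ) (hc : c ≠ 0) (v : Fin 3 → ℝ) (hv : v ≠ 0) :
    ∃ h : c • ![v 0 + t * v 1, v 1, Real.exp (-(a * t)) * v 2] ≠ 0,
      psi a t (Projectivization.mk ℝ v hv) = Projectivization.mk ℝ _ h := by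
  have h0 : psiMat a t *ᵥ v ≠ 0 := fun h =>
    hv (psiMat_injective a t (by simpa [Matrix.mulVecLin_apply] using h))
  rw [← psiMat_mulVec]
  refine ⟨smul_ne_zero hc h0, ?_⟩
  rw [psi, Projectivization.map_mk, Projectivization.mk_eq_mk_iff']
  exact ⟨c⁻¹, by simp [smul_smul, hc]⟩

lemma tendsto_exp_neg_mul_atTop {a : ℝ} (ha : 0 < a) :
    Tendsto (fun t : ℝ => Real.exp (-(a * t))) atTop (nhds 0) :=
  Real.tendsto_exp_neg_atTop_nhds_zero.comp (tendsto_id.const_mul_atTop ha)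

/-- Every point is either fixed by the flow `psi` or attracted by the first basis point. -/
lemma psi_fixed_or_tendsto {a : ℝ} (ha : 0 < a) (p : ℙ ℝ (Fin 3 → ℝ)) :
    (∀ t, psi a t p = p) ∨
      Tendsto (fun t => psi a t p) atTop
        (nhds (Projectivization.mk ℝ ![1, 0, 0] basis_zero_ne_zero)) := by
  induction p using Projectivization.ind with
  | h v hv =>
  have hE := tendsto_exp_neg_mul_atTop ha
  by_cases h1 : v 1 = 0
  · by_cases h0 : v 0 = 0
    · left
      intro t
      obtain ⟨h, e⟩ := psi_mk_eq a t (Real.exp (a * t)) (Real.exp_ne_zero _) v hv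
      rw [e]
      congr 1
      ext i
      fin_cases i <;> simp [h0, h1, ← mul_assoc, ← Real.exp_add]
    · right
      refine tendsto_projectivization_mk
        (w := fun t => (v 0)⁻¹ • ![v 0 + t * v 1, v 1, Real.exp (-(a * t)) * v 2]) _ ?_
        (Eventually.of_forall fun t => psi_mk_eq a t _ (inv_ne_zero h0) v hv)
      rw [tendsto_pi_nhds]
      intro i
      fin_cases i
      · simp [h0, h1]
      · simp [h1]
      · simpa using (hE.mul_const (v 2)).const_mul (v 0)⁻¹
  · right
    refine tendsto_projectivization_mk
      (w := fun t => (t * v 1)⁻¹ • ![v 0 + t * v 1, v 1, Real.exp (-(a * t)) * v 2]) _ ?_ ?_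
    · have hT : Tendsto (fun t : ℝ => (t * v 1)⁻¹) atTop (nhds 0) := by
        simpa using (tendsto_inv_atTop_zero (𝕜 := ℝ)).const_mul (v 1)⁻¹
      rw [tendsto_pi_nhds]
      intro i
      fin_cases i
      · have h : Tendsto (fun t : ℝ => (t * v 1)⁻¹ * v 0 + 1) atTop (nhds 1) := by
          simpa using (hT.mul_const (v 0)).add_const 1
        refine h.congr' ?_
        filter_upwards [eventually_ne_atTop 0] with t ht
        simp [mul_add]
        field_simp
      · simpa using hT.mul_const (v 1)
      · simpa using hT.mul (hE.mul_const (v 2))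
    · filter_upwards [eventually_ne_atTop 0] with t ht
      exact psi_mk_eq a t _ (inv_ne_zero (mul_ne_zero ht h1)) v hv

lemma tendsto_firstCoordSq_phi {a : ℝ} (ha : 0 < a) (hv : ![(1 : ℝ), 0, 1] ≠ 0) :
    Tendsto (fun t => firstCoordSq (phi a t (Projectivization.mk ℝ ![1, 0, 1] hv)))
      atTop (nhds 1) := by
  have hE := tendsto_exp_neg_mul_atTop ha
  have hT : Tendsto (fun t : ℝ => Real.exp (-(a * t)) * t) atTop (nhds 0) := by
    have h := (Real.tendsto_pow_mul_exp_neg_atTop_nhds_zero 1).comp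
      (tendsto_id.const_mul_atTop ha : Tendsto (fun t : ℝ => a * t) atTop atTop)
    have h' := h.const_mul a⁻¹
    rw [mul_zero] at h'
    refine h'.congr fun t => ?_
    simp only [Function.comp_apply, pow_one]
    field_simp
  have h : Tendsto (fun t : ℝ => 1 / (1 + (Real.exp (-(a * t)) * t) ^ 2
      + Real.exp (-(a * t)) ^ 2)) atTop (nhds 1) := by
    have h' := ((hT.pow 2).const_add 1).add (hE.pow 2)
    simpa using h'.inv₀ (by norm_num)
  refine h.congr fun t => ?_
  rw [firstCoordSq_phi, Real.exp_neg]
  have := Real.exp_pos (a * t)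
  field_simp
  ring

theorem flows_phi_psi_not_topologically_conjugate (a : ℝ) (ha : 0 < a) :
    ¬ ∃ h : ℙ ℝ (Fin 3 → ℝ) ≃ₜ ℙ ℝ (Fin 3 → ℝ),
        ∀ t : ℝ, (h : ℙ ℝ (Fin 3 → ℝ) → ℙ ℝ (Fin 3 → ℝ)) ∘ phi a t = psi a t ∘ h := by
  rintro ⟨h, hconj⟩
  have hpsi (t : ℝ) (p) : psi a t (h p) = h (phi a t p) := (congrFun (hconj t) p).symm
  set r := h.symm (Projectivization.mk ℝ ![1, 0, 0] basis_zero_ne_zero)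
  have key (p) : (∀ t, phi a t p = p) ∨
      Tendsto (fun t => firstCoordSq (phi a t p)) atTop (nhds (firstCoordSq r)) := by
    refine (psi_fixed_or_tendsto ha (h p)).imp (fun hp t => h.injective ?_) fun hp => ?_
    · rw [← hpsi, hp]
    · have hr := ((continuous_firstCoordSq.comp h.symm.continuous).tendsto _).comp hp
      simpa [Function.comp_def, hpsi] using hr
  have hp0 : ![(1 : ℝ), 0, 1] ≠ 0 := fun e => one_ne_zero (congrFun e 0)
  have hq0 : ![(0 : ℝ), 0, 1] ≠ 0 := fun e => one_ne_zero (congrFun e 2)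
  have hp := tendsto_firstCoordSq_phi ha hp0
  have hr1 : firstCoordSq r = 1 := by
    rcases key (Projectivization.mk ℝ _ hp0) with hfix | hlim
    · simp only [hfix, firstCoordSq_mk] at hp
      have := tendsto_nhds_unique hp tendsto_const_nhds
      norm_num [Matrix.cons_val_two] at this
    · exact tendsto_nhds_unique hlim hp
  have hr0 : firstCoordSq r = 0 := by
    rcases key (Projectivization.mk ℝ _ hq0) with hfix | hlim
    · have h1 := hfix 1
      rw [phi, Projectivization.map_mk, Projectivization.mk_eq_mk_iff'] at h1
      obtain ⟨c, hc⟩ := h1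
      rw [Matrix.mulVecLin_apply, phiMat_mulVec] at hc
      simpa using congrFun hc 1
    · simp only [firstCoordSq_phi] at hlim
      exact tendsto_nhds_unique hlim (by simp)
  exact one_ne_zero (hr1.symm.trans hr0)
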